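/- Let k ≥ 2 and d ≥ 2^k + 1 be integers. Then for every coprime pair (a, q) with 1 ≤ a ≤ q, the inner sum of the singular series satisfies |∑_{a=1, (a,q)=1}^{q} G(a/q)^d e^{-2πi N a/q}| ≤ C_k q^{-11/10} for a constant C_k depending only on k, uniformly in N ∈ ℕ. -/

import Mathlib

noncomputable def e (x : ℝ) : ℂ := Complex.exp (2 * Real.pi * Complex.I * x)

noncomputable def warGauss (k q a : ℕ) : ℂ :=
  (q : ℂ)⁻¹ * ∑ r ∈ Finset.Icc 1 q, e ((a : ℝ) * (r : ℝ) ^ k / (q : ℝ))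

open Finset

/-- The sum of an additive character over the `k`-th powers of all elements. -/
noncomputable def powSum {R : Type*} [CommRing R] [Fintype R] (k : ℕ) (ψ : AddChar R ℂ) : ℂ :=
  ∑ x : R, ψ (x ^ k)

section General

variable {R : Type*} [CommRing R] [Fintype R]

theorem norm_powSum_le_card (k : ℕ) (ψ : AddChar R ℂ) : ‖powSum k ψ‖ ≤ Fintype.card R := by
  refine (norm_sum_le _ _).trans ?_
  simp

/-- The `k`-th power sum over units vanishes when some square-zero element `t` has `k t ≠ 0`. -/
theorem sum_units_pow_eq_zero [Fintype Rˣ] {ψ : AddChar R ℂ} (hψ : ψ.IsPrimitive) (k : ℕ) {t : R}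
    (ht : t ^ 2 = 0) (hkt : (k : R) * t ≠ 0) : ∑ u : Rˣ, ψ ((u : R) ^ k) = 0 := by
  classical
  have key : ∀ y : R, ∑ u : Rˣ, ψ ((u : R) ^ k) =
      ∑ u : Rˣ, ψ ((u : R) ^ k) * ψ (y * ((u : R) ^ k * (k * t))) := by
    intro y
    have hn : IsNilpotent (t * y) := ⟨2, by rw [mul_pow, ht, zero_mul]⟩
    obtain ⟨v, hv⟩ := hn.isUnit_one_add
    have hvk : (v : R) ^ k = 1 + k * (t * y) := by
      rw [hv]
      clear hkt
      induction k with
      | zero => simp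
      | succ k ih =>
        rw [pow_succ, ih]
        push_cast
        linear_combination (k * y ^ 2) * ht
    rw [← Equiv.sum_comp (Equiv.mulRight v)]
    refine sum_congr rfl fun u _ => ?_
    rw [← AddChar.map_add_eq_mul]
    congr 1
    simp only [Equiv.coe_mulRight, Units.val_mul, mul_pow, hvk]
    ring
  have h0 : ∑ _y : R, ∑ u : Rˣ, ψ ((u : R) ^ k) = 0 := by
    rw [sum_congr rfl fun y _ => key y, sum_comm]
    refine sum_eq_zero fun u _ => ?_
    rw [← mul_sum, AddChar.sum_mulShift _ hψ, if_neg]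
    · simp
    · exact fun h => hkt (((u.isUnit.pow k).mul_right_eq_zero).1 h)
  rw [sum_const, card_univ, nsmul_eq_mul] at h0
  exact (mul_eq_zero.1 h0).resolve_left (Nat.cast_ne_zero.2 Fintype.card_ne_zero)

theorem powSum_eq_units_add_nonunits [Fintype Rˣ] [DecidablePred (IsUnit : R → Prop)] (k : ℕ)
    (ψ : AddChar R ℂ) :
    powSum k ψ = ∑ u : Rˣ, ψ ((u : R) ^ k) + ∑ x : R with ¬ IsUnit x, ψ (x ^ k) := by
  rw [powSum, ← sum_filter_add_sum_filter_not univ (IsUnit : R → Prop)]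
  congr 1
  symm
  refine sum_bij (fun u _ => (u : R)) (by simp) (fun _ _ _ _ h => Units.ext h) ?_ (by simp)
  intro b hb
  obtain ⟨u, hu⟩ := (mem_filter.1 hb).2
  exact ⟨u, mem_univ _, hu⟩

theorem powSum_comp_ringEquiv {S : Type*} [CommRing S] [Fintype S] (k : ℕ) (f : S ≃+* R)
    (ψ : AddChar R ℂ) :
    powSum k (ψ.compAddMonoidHom (f : S →+ R)) = powSum k ψ := by
  rw [powSum, powSum, ← Equiv.sum_comp f.toEquiv]
  simp

theorem isPrimitive_comp_ringEquiv {R S : Type*} [CommRing R] [CommRing S] (f : S ≃+* R)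
    {ψ : AddChar R ℂ} (hψ : ψ.IsPrimitive) :
    (ψ.compAddMonoidHom (f : S →+ R)).IsPrimitive := by
  intro a ha h
  refine hψ (a := f a) (by simpa using ha) ?_
  ext x
  simpa using DFunLike.congr_fun h (f.symm x)

theorem powSum_prod {S : Type*} [CommRing S] [Fintype S] {k : ℕ} (ψ : AddChar (R × S) ℂ) :
    powSum k ψ = powSum k (ψ.compAddMonoidHom (AddMonoidHom.inl R S)) *
      powSum k (ψ.compAddMonoidHom (AddMonoidHom.inr R S)) := by
  simp only [powSum, Fintype.sum_prod_type, sum_mul_sum]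
  refine sum_congr rfl fun x _ => sum_congr rfl fun y _ => ?_
  simp [← AddChar.map_add_eq_mul]

theorem isPrimitive_comp_inl {R S : Type*} [CommRing R] [CommRing S] {ψ : AddChar (R × S) ℂ}
    (hψ : ψ.IsPrimitive) : (ψ.compAddMonoidHom (AddMonoidHom.inl R S)).IsPrimitive := by
  intro a ha h
  refine hψ (a := (a, 0)) (by simpa using ha) ?_
  ext ⟨x, y⟩
  simpa using DFunLike.congr_fun h x

theorem isPrimitive_comp_inr {R S : Type*} [CommRing R] [CommRing S] {ψ : AddChar (R × S) ℂ}
    (hψ : ψ.IsPrimitive) : (ψ.compAddMonoidHom (AddMonoidHom.inr R S)).IsPrimitive := by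
  intro a ha h
  refine hψ (a := (0, a)) (by simpa using ha) ?_
  ext ⟨x, y⟩
  simpa using DFunLike.congr_fun h y

end General

section Field

variable {F : Type*} [Field F] [Fintype F]

theorem card_pow_eq_le [DecidableEq F] {k : ℕ} (hk : 0 < k) (b : F) :
    #{x : F | x ^ k = b} ≤ k := by
  refine le_trans ?_ (Polynomial.card_nthRoots k b)
  refine le_trans (card_le_card ?_) (Multiset.toFinset_card_le _)
  intro x hx
  simpa [Polynomial.mem_nthRoots hk] using hx

theorem sum_norm_sq_powSum_le [DecidableEq F] {ψ : AddChar F ℂ} (hψ : ψ.IsPrimitive) {k : ℕ}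
    (hk : 0 < k) :
    ∑ b : F, ‖powSum k (ψ.mulShift b)‖ ^ 2 ≤ (Fintype.card F : ℝ) ^ 2 * k := by
  have h : ((∑ b : F, ‖powSum k (ψ.mulShift b)‖ ^ 2 : ℝ) : ℂ) =
      ((Fintype.card F * ∑ x : F, #{y : F | y ^ k = x ^ k} : ℕ) : ℂ) := by
    push_cast
    have : ∀ b : F, ((‖powSum k (ψ.mulShift b)‖ : ℂ)) ^ 2 =
        ∑ x : F, ∑ y : F, ψ (b * (x ^ k - y ^ k)) := by
      intro b
      rw [← Complex.mul_conj', powSum, map_sum, sum_mul_sum]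
      refine sum_congr rfl fun x _ => sum_congr rfl fun y _ => ?_
      rw [← AddChar.map_neg_eq_conj, ← AddChar.map_add_eq_mul, AddChar.mulShift_apply]
      ring_nf
    rw [sum_congr rfl fun b _ => this b, sum_comm, mul_sum]
    refine sum_congr rfl fun x _ => ?_
    rw [sum_comm, card_filter, Nat.cast_sum, mul_sum]
    refine sum_congr rfl fun y _ => ?_
    rw [AddChar.sum_mulShift _ hψ]
    simp [sub_eq_zero, eq_comm]
  rw [← Complex.ofReal_natCast, Complex.ofReal_inj] at h
  rw [h]
  have : ∑ x : F, #{y : F | y ^ k = x ^ k} ≤ Fintype.card F * k := by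
    refine (sum_le_sum fun x _ => card_pow_eq_le hk _).trans ?_
    simp
  calc ((Fintype.card F * ∑ x : F, #{y : F | y ^ k = x ^ k} : ℕ) : ℝ)
      ≤ ((Fintype.card F * (Fintype.card F * k) : ℕ) : ℝ) := by gcongr
    _ = _ := by push_cast; ring

theorem powSum_mulShift_pow (ψ : AddChar F ℂ) (k : ℕ) {c : F} (hc : c ≠ 0) :
    powSum k (ψ.mulShift (c ^ k)) = powSum k ψ := by
  rw [powSum, powSum, ← Equiv.sum_comp (Equiv.mulLeft₀ c hc) (fun x => ψ (x ^ k))]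
  simp [mul_pow]

theorem norm_powSum_le_of_field {ψ : AddChar F ℂ} (hψ : ψ.IsPrimitive) {k : ℕ} (hk : 0 < k) :
    ‖powSum k ψ‖ ≤ 2 * k * √(Fintype.card F) := by
  classical
  set f : F → ℝ := fun b => ‖powSum k (ψ.mulShift b)‖ ^ 2 with hf
  set Q : ℝ := (Fintype.card F : ℝ) with hQ
  have hQ2 : 2 ≤ Q := by
    rw [hQ]
    exact_mod_cast Fintype.one_lt_card (α := F)
  have h1 : ∑ c : Fˣ, f ((c : F) ^ k) = (Q - 1) * ‖powSum k ψ‖ ^ 2 := by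
    simp only [hf, powSum_mulShift_pow ψ k (Units.ne_zero _)]
    rw [sum_const, card_univ, Fintype.card_units, nsmul_eq_mul, Nat.cast_sub Fintype.card_pos,
      Nat.cast_one]
  have h2 : ∑ c : Fˣ, f ((c : F) ^ k) ≤ ∑ c : F, f (c ^ k) := by
    refine le_of_eq_of_le (sum_map univ (⟨Units.val, Units.val_injective⟩ : Fˣ ↪ F)
      (fun c => f (c ^ k))).symm ?_
    exact sum_le_sum_of_subset_of_nonneg (subset_univ _) fun _ _ _ => by positivity
  have h3 : ∑ c : F, f (c ^ k) ≤ k * ∑ b : F, f b := by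
    rw [← sum_fiberwise univ (fun c : F => c ^ k) (fun c => f (c ^ k)), mul_sum]
    refine sum_le_sum fun b _ => ?_
    rw [sum_congr rfl (g := fun _ => f b) fun c hc => by rw [(mem_filter.1 hc).2], sum_const,
      nsmul_eq_mul]
    exact mul_le_mul_of_nonneg_right (by exact_mod_cast card_pow_eq_le hk b) (by positivity)
  have h4 := sum_norm_sq_powSum_le hψ hk
  have h5 : (Q - 1) * ‖powSum k ψ‖ ^ 2 ≤ k * (Q ^ 2 * k) :=
    h1 ▸ h2.trans (h3.trans (mul_le_mul_of_nonneg_left h4 (by positivity)))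
  have h6 : ‖powSum k ψ‖ ^ 2 ≤ (2 * k * √Q) ^ 2 := by
    rw [mul_pow, Real.sq_sqrt (by positivity)]
    have : (Q - 1) * ‖powSum k ψ‖ ^ 2 ≤ (Q - 1) * ((2 * k) ^ 2 * Q) := by
      refine h5.trans ?_
      have : (0 : ℝ) ≤ (k : ℝ) ^ 2 * Q * (3 * Q - 4) :=
        mul_nonneg (by positivity) (by linarith)
      nlinarith
    exact le_of_mul_le_mul_left this (by linarith)
  exact le_of_sq_le_sq h6 (by positivity)

end Field

section PrimePower

/-- Multiplication by `c`, as a map from the integers mod `n` to the integers mod `N ∣ c * n`. -/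
def scaleHom {n N : ℕ} (c : ℕ) (h : N ∣ c * n) : ZMod n →+ ZMod N :=
  ZMod.lift n ⟨(AddMonoidHom.mulLeft (c : ZMod N)).comp (Int.castAddHom (ZMod N)), by
    simpa using mod_cast (ZMod.natCast_eq_zero_iff (c * n) N).2 h⟩

theorem scaleHom_intCast {n N : ℕ} (c : ℕ) (h : N ∣ c * n) (j : ℤ) :
    scaleHom c h (j : ZMod n) = c * j := by
  simp [scaleHom]

theorem scaleHom_injective {n c : ℕ} (hc : c ≠ 0) {N : ℕ} (h : N = c * n) :
    Function.Injective (scaleHom (n := n) (N := N) c h.dvd) := by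
  rw [injective_iff_map_eq_zero]
  intro x hx
  obtain ⟨j, rfl⟩ := ZMod.intCast_surjective x
  rw [scaleHom_intCast] at hx
  have hx' : ((c * j : ℤ) : ZMod N) = 0 := by exact_mod_cast hx
  rw [ZMod.intCast_zmod_eq_zero_iff_dvd] at hx' ⊢
  rw [h, Nat.cast_mul] at hx'
  exact (mul_dvd_mul_iff_left (by exact_mod_cast hc)).1 hx'

theorem isPrimitive_comp_scaleHom {n c : ℕ} (hc : c ≠ 0) {N : ℕ} (h : N = c * n)
    {ψ : AddChar (ZMod N) ℂ} (hψ : ψ.IsPrimitive) :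
    (ψ.compAddMonoidHom (scaleHom (n := n) c h.dvd)).IsPrimitive := by
  intro a ha h1
  refine hψ (a := scaleHom c h.dvd a)
    (fun h0 => ha (scaleHom_injective hc h (h0.trans (map_zero _).symm))) ?_
  ext x
  obtain ⟨i, rfl⟩ := ZMod.intCast_surjective x
  obtain ⟨j, rfl⟩ := ZMod.intCast_surjective a
  have := DFunLike.congr_fun h1 (i : ZMod n)
  rw [AddChar.mulShift_apply, AddChar.compAddMonoidHom_apply, ← Int.cast_mul,
    scaleHom_intCast] at this
  rw [AddChar.mulShift_apply, scaleHom_intCast, mul_assoc, ← Int.cast_mul]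
  exact this

/-- Summing over a multiple of the period. -/
theorem sum_comp_castHom {n N : ℕ} [NeZero n] [NeZero N] (h : n ∣ N) (f : ZMod n → ℂ) :
    ∑ x : ZMod N, f (ZMod.castHom h (ZMod n) x) = ((N / n : ℕ) : ℂ) * ∑ y : ZMod n, f y := by
  have hsurj := ZMod.castHom_surjective h
  set K := #{x : ZMod N | ZMod.castHom h (ZMod n) x = 0} with hK
  have hfib : ∀ y : ZMod n, #{x : ZMod N | ZMod.castHom h (ZMod n) x = y} = K := fun y =>
    AddMonoidHom.card_fiber_eq_of_mem_range (ZMod.castHom h (ZMod n)) (hsurj y) (hsurj 0)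
  have hsum : ∀ g : ZMod n → ℂ,
      ∑ x : ZMod N, g (ZMod.castHom h (ZMod n) x) = (K : ℂ) * ∑ y : ZMod n, g y := by
    intro g
    rw [← sum_fiberwise univ (fun x => ZMod.castHom h (ZMod n) x), mul_sum]
    refine sum_congr rfl fun y _ => ?_
    rw [sum_congr rfl (g := fun _ => g y) fun c hc => by rw [(mem_filter.1 hc).2], sum_const,
      nsmul_eq_mul, hfib]
  have hcard := hsum fun _ => 1
  simp only [sum_const, card_univ, ZMod.card, nsmul_eq_mul, mul_one] at hcard
  have hN : N = K * n := by exact_mod_cast hcard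
  rw [hsum, hN, Nat.mul_div_cancel _ (Nat.pos_of_ne_zero (NeZero.ne n))]

variable {p : ℕ} [Fact p.Prime]

theorem sum_nonunits_prime_pow {m : ℕ} (f : ZMod (p ^ (m + 1)) → ℂ)
    [DecidablePred (IsUnit : ZMod (p ^ (m + 1)) → Prop)] :
    ∑ x : ZMod (p ^ (m + 1)) with ¬ IsUnit x, f x =
      ∑ z : ZMod (p ^ m), f (scaleHom p (pow_succ' p m).dvd z) := by
  have hp : p.Prime := Fact.out
  symm
  refine sum_bij (fun z _ => scaleHom p (pow_succ' p m).dvd z) ?_ ?_ ?_ (fun _ _ => rfl)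
  · intro z _
    obtain ⟨j, rfl⟩ := ZMod.natCast_zmod_surjective z
    have := scaleHom_intCast p (pow_succ' p m).dvd j
    rw [Int.cast_natCast, Int.cast_natCast] at this
    rw [mem_filter, this, ← Nat.cast_mul,
      ZMod.isUnit_natCast_iff_not_dvd_pow hp (Nat.succ_pos m)]
    simp
  · exact fun _ _ _ _ h => scaleHom_injective hp.ne_zero (pow_succ' p m) h
  · intro x hx
    obtain ⟨j, rfl⟩ := ZMod.natCast_zmod_surjective x
    rw [mem_filter, ZMod.isUnit_natCast_iff_not_dvd_pow hp (Nat.succ_pos m), not_not] at hx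
    obtain ⟨i, rfl⟩ := hx.2
    refine ⟨((i : ℤ) : ZMod (p ^ m)), mem_univ _, ?_⟩
    rw [scaleHom_intCast]
    push_cast
    rfl

theorem norm_sum_nonunits_le {m k : ℕ} (ψ : AddChar (ZMod (p ^ (m + 1))) ℂ)
    [DecidablePred (IsUnit : ZMod (p ^ (m + 1)) → Prop)] :
    ‖∑ x : ZMod (p ^ (m + 1)) with ¬ IsUnit x, ψ (x ^ k)‖ ≤ (p : ℝ) ^ m := by
  rw [sum_nonunits_prime_pow]
  refine (norm_sum_le _ _).trans ?_
  simp [ZMod.card]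

theorem sum_nonunits_pow_eq {m k : ℕ} (ψ : AddChar (ZMod (p ^ (m + (k + 1)))) ℂ)
    [DecidablePred (IsUnit : ZMod (p ^ (m + (k + 1))) → Prop)] :
    ∑ x : ZMod (p ^ (m + (k + 1))) with ¬ IsUnit x, ψ (x ^ (k + 1)) =
      (p : ℂ) ^ k * powSum (k + 1) (ψ.compAddMonoidHom
        (scaleHom (n := p ^ m) (p ^ (k + 1)) (by rw [pow_add, mul_comm]))) := by
  have hp : p.Prime := Fact.out
  have hd : p ^ m ∣ p ^ (m + k) := pow_dvd_pow _ (Nat.le_add_right _ _)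
  have h := sum_nonunits_prime_pow (p := p) (m := m + k) (fun x => ψ (x ^ (k + 1)))
  refine h.trans ?_
  have hc := sum_comp_castHom hd (fun y => ψ (scaleHom (N := p ^ (m + (k + 1)))
    (p ^ (k + 1)) (by rw [pow_add, mul_comm]) (y ^ (k + 1))))
  have hdiv : p ^ (m + k) / p ^ m = p ^ k := by
    rw [pow_add, Nat.mul_div_cancel_left _ (pow_pos hp.pos m)]
  rw [hdiv, Nat.cast_pow] at hc
  refine Eq.trans (sum_congr rfl fun x _ => ?_) hc
  obtain ⟨j, rfl⟩ := ZMod.intCast_surjective x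
  rw [map_intCast (ZMod.castHom hd (ZMod (p ^ m))), ← Int.cast_pow, scaleHom_intCast,
    scaleHom_intCast]
  congr 1
  push_cast
  ring

theorem sum_units_prime_pow_eq_zero {m s k : ℕ} (h2s : m ≤ 2 * s) (hk : ¬ p ^ m ∣ k * p ^ s)
    {ψ : AddChar (ZMod (p ^ m)) ℂ} (hψ : ψ.IsPrimitive) :
    ∑ u : (ZMod (p ^ m))ˣ, ψ ((u : ZMod (p ^ m)) ^ k) = 0 := by
  refine sum_units_pow_eq_zero hψ k (t := ((p ^ s : ℕ) : ZMod (p ^ m))) ?_ ?_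
  · rw [← Nat.cast_pow, ZMod.natCast_eq_zero_iff, ← pow_mul, mul_comm]
    exact pow_dvd_pow _ h2s
  · rwa [← Nat.cast_mul, Ne, ZMod.natCast_eq_zero_iff]

/-- A bound on power sums that holds at the level `p ^ m` follows at level `p ^ (m + k)`. -/
theorem norm_powSum_prime_pow_step {m k s : ℕ} (hk0 : 0 < k) (h2s : m + k ≤ 2 * s)
    (hk : ¬ p ^ (m + k) ∣ k * p ^ s) {θ C : ℝ} (hθ : k * θ ≤ 1)
    (ih : ∀ ψ : AddChar (ZMod (p ^ m)) ℂ, ψ.IsPrimitive →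
      ‖powSum k ψ‖ ≤ C * ((p ^ m : ℕ) : ℝ) ^ (1 - θ))
    {ψ : AddChar (ZMod (p ^ (m + k))) ℂ} (hψ : ψ.IsPrimitive) :
    ‖powSum k ψ‖ ≤ C * ((p ^ (m + k) : ℕ) : ℝ) ^ (1 - θ) := by
  classical
  have hp : p.Prime := Fact.out
  have hp1 : (1 : ℝ) ≤ p := by exact_mod_cast hp.one_lt.le
  have hp0 : (0 : ℝ) < p := by linarith
  obtain ⟨k, rfl⟩ : ∃ l, k = l + 1 := ⟨k - 1, by omega⟩
  rw [powSum_eq_units_add_nonunits, sum_units_prime_pow_eq_zero h2s hk hψ, zero_add,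
    sum_nonunits_pow_eq, norm_mul, norm_pow, Complex.norm_natCast]
  have h := ih _ (isPrimitive_comp_scaleHom (n := p ^ m) (pow_ne_zero (k + 1) hp.ne_zero)
    (by rw [pow_add, mul_comm]) hψ)
  have hC : 0 ≤ C := by
    by_contra! hC
    have : C * ((p ^ m : ℕ) : ℝ) ^ (1 - θ) < 0 :=
      mul_neg_of_neg_of_pos hC (Real.rpow_pos_of_pos (by exact_mod_cast pow_pos hp.pos m) _)
    linarith [norm_nonneg (powSum (k + 1) (ψ.compAddMonoidHom
        (scaleHom (n := p ^ m) (p ^ (k + 1)) (by rw [pow_add, mul_comm]))))]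
  have hexp : (p : ℝ) ^ k ≤ ((p : ℝ) ^ (k + 1)) ^ (1 - θ) := by
    rw [← Real.rpow_natCast, ← Real.rpow_natCast, ← Real.rpow_mul hp0.le]
    refine Real.rpow_le_rpow_of_exponent_le hp1 ?_
    push_cast at hθ ⊢
    linarith
  calc (p : ℝ) ^ k * _ ≤ ((p : ℝ) ^ (k + 1)) ^ (1 - θ) * (C * ((p ^ m : ℕ) : ℝ) ^ (1 - θ)) := by
        gcongr
    _ = C * ((p ^ (m + (k + 1)) : ℕ) : ℝ) ^ (1 - θ) := by
        push_cast
        rw [pow_add (p : ℝ) m, Real.mul_rpow (by positivity) (by positivity)]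
        ring

/-- Power sums modulo powers of an arbitrary prime. -/
theorem norm_powSum_prime_pow_le {k : ℕ} (hk : 0 < k) {θ : ℝ} (hθ0 : 0 ≤ θ) (hθ : k * θ ≤ 1)
    (m : ℕ) {ψ : AddChar (ZMod (p ^ m)) ℂ} (hψ : ψ.IsPrimitive) :
    ‖powSum k ψ‖ ≤ (p : ℝ) ^ 2 * ((p ^ m : ℕ) : ℝ) ^ (1 - θ) := by
  have hp : p.Prime := Fact.out
  have hp1 : (1 : ℝ) ≤ p := by exact_mod_cast hp.one_lt.le
  have hp0 : (0 : ℝ) < p := by linarith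
  induction m using Nat.strong_induction_on with
  | _ m ih =>
    rcases lt_or_ge m (2 * k) with hm | hm
    · refine (norm_powSum_le_card k ψ).trans ?_
      have hq : (0 : ℝ) < ((p ^ m : ℕ) : ℝ) := by exact_mod_cast pow_pos hp.pos m
      rw [ZMod.card, Real.rpow_sub hq, Real.rpow_one, mul_div_assoc',
        le_div_iff₀ (Real.rpow_pos_of_pos hq _), mul_comm]
      gcongr
      push_cast
      rw [← Real.rpow_natCast, ← Real.rpow_natCast, ← Real.rpow_mul hp0.le]
      refine Real.rpow_le_rpow_of_exponent_le hp1 ?_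
      have : (m : ℝ) ≤ 2 * k := by exact_mod_cast hm.le
      push_cast
      nlinarith
    · obtain ⟨n, rfl⟩ : ∃ n, m = n + k := ⟨m - k, by omega⟩
      refine norm_powSum_prime_pow_step hk (s := n) (by omega) ?_ hθ
        (fun ψ hψ => ih n (by omega) hψ) hψ
      rw [pow_add, mul_comm, Nat.mul_dvd_mul_iff_right (pow_pos hp.pos n)]
      exact fun h => absurd (Nat.le_of_dvd hk h) (Nat.lt_pow_self hp.one_lt).not_ge

/-- Power sums modulo powers of a large prime. -/
theorem norm_powSum_large_prime_pow_le {k : ℕ} (hk : 2 ≤ k) {θ : ℝ}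
    (hθ : k * θ ≤ 1) (hpk : k < p) (hpθ : 2 * k * (p : ℝ) ^ θ ≤ √p)
    (m : ℕ) {ψ : AddChar (ZMod (p ^ m)) ℂ} (hψ : ψ.IsPrimitive) :
    ‖powSum k ψ‖ ≤ 1 * ((p ^ m : ℕ) : ℝ) ^ (1 - θ) := by
  classical
  have hp : p.Prime := Fact.out
  have hp1 : (1 : ℝ) ≤ p := by exact_mod_cast hp.one_lt.le
  have hp0 : (0 : ℝ) < p := by linarith
  have hpk' : ¬ p ∣ k := fun h => absurd (Nat.le_of_dvd (by omega) h) (by omega)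
  have hdvd : ∀ n, ¬ p ^ (n + 1) ∣ k * p ^ n := by
    intro n
    rwa [pow_succ', Nat.mul_dvd_mul_iff_right (pow_pos hp.pos n)]
  induction m using Nat.strong_induction_on with
  | _ m ih =>
    rcases Nat.lt_or_ge k m with hm | hm
    · obtain ⟨n, rfl⟩ : ∃ n, m = n + k := ⟨m - k, by omega⟩
      refine norm_powSum_prime_pow_step (by omega) (s := n + k - 1) (by omega) ?_ hθ
        (fun ψ hψ => ih n (by omega) hψ) hψ
      have := hdvd (n + k - 1)
      rwa [Nat.sub_add_cancel (by omega)] at this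
    · rcases m with _ | _ | m
      · refine (norm_powSum_le_card k ψ).trans ?_
        simp
      · have : Fact (p ^ (0 + 1)).Prime := ⟨by simpa using hp⟩
        have h := norm_powSum_le_of_field hψ (by omega : 0 < k)
        rw [ZMod.card] at h
        refine h.trans ?_
        rw [zero_add, pow_one, one_mul, Real.rpow_sub hp0, Real.rpow_one,
          le_div_iff₀ (by positivity)]
        calc 2 * k * √p * (p : ℝ) ^ θ = 2 * k * (p : ℝ) ^ θ * √p := by ring
          _ ≤ √p * √p := by gcongr
          _ = p := Real.mul_self_sqrt hp0.le
      · rw [powSum_eq_units_add_nonunits,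
          sum_units_prime_pow_eq_zero (s := m + 1) (by omega) (hdvd (m + 1)) hψ, zero_add, one_mul]
        refine (norm_sum_nonunits_le ψ).trans ?_
        push_cast
        rw [← Real.rpow_natCast, ← Real.rpow_natCast, ← Real.rpow_mul hp0.le]
        refine Real.rpow_le_rpow_of_exponent_le hp1 ?_
        have hm' : ((m + 1 + 1 : ℕ) : ℝ) ≤ k := by exact_mod_cast hm
        push_cast at hm' ⊢
        rcases le_total 0 θ with h0 | h0 <;> nlinarith

end PrimePower

section Modulus

theorem norm_powSum_zmod_le {k : ℕ} {θ : ℝ} {c : ℕ → ℝ}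
    (hc : ∀ p m : ℕ, p.Prime → ∀ [NeZero (p ^ m)], ∀ ψ : AddChar (ZMod (p ^ m)) ℂ,
      ψ.IsPrimitive → ‖powSum k ψ‖ ≤ c p * ((p ^ m : ℕ) : ℝ) ^ (1 - θ)) (q : ℕ) :
    ∀ [NeZero q], ∀ ψ : AddChar (ZMod q) ℂ, ψ.IsPrimitive →
      ‖powSum k ψ‖ ≤ (∏ p ∈ q.primeFactors, c p) * (q : ℝ) ^ (1 - θ) := by
  induction q using Nat.recOnPosPrimePosCoprime with
  | zero => exact fun {h} => absurd rfl h.out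
  | one =>
    intro _ ψ _
    refine (norm_powSum_le_card k ψ).trans ?_
    simp
  | prime_pow p n hp hn =>
    intro _ ψ hψ
    rw [Nat.primeFactors_prime_pow hn.ne' hp, prod_singleton]
    exact hc p n hp ψ hψ
  | coprime a b ha hb hab iha ihb =>
    intro _ ψ hψ
    have : NeZero a := ⟨by omega⟩
    have : NeZero b := ⟨by omega⟩
    have hφ := isPrimitive_comp_ringEquiv (ZMod.chineseRemainder hab).symm hψ
    have ha' := iha _ (isPrimitive_comp_inl hφ)
    have hb' := ihb _ (isPrimitive_comp_inr hφ)
    rw [← powSum_comp_ringEquiv k (ZMod.chineseRemainder hab).symm, powSum_prod, norm_mul]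
    refine (mul_le_mul ha' hb' (norm_nonneg _) ((norm_nonneg _).trans ha')).trans_eq ?_
    rw [hab.primeFactors_mul, prod_union hab.disjoint_primeFactors, Nat.cast_mul,
      Real.mul_rpow (by positivity) (by positivity)]
    ring

theorem two_mul_mul_rpow_le_sqrt {k p : ℕ} {θ : ℝ} (hθ : θ ≤ 21 / 50)
    (hp : (2 * k) ^ 13 < p) : 2 * k * (p : ℝ) ^ θ ≤ √p := by
  have hp1 : (1 : ℝ) ≤ p := by exact_mod_cast (by omega : 1 ≤ p)
  have hp0 : (0 : ℝ) < p := by linarith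
  have h1 : (2 * k : ℝ) ≤ (p : ℝ) ^ ((13 : ℝ)⁻¹) := by
    rw [Real.le_rpow_inv_iff_of_pos (by positivity) hp0.le (by norm_num)]
    exact_mod_cast hp.le
  calc 2 * k * (p : ℝ) ^ θ ≤ (p : ℝ) ^ ((13 : ℝ)⁻¹) * (p : ℝ) ^ θ := by gcongr
    _ = (p : ℝ) ^ ((13 : ℝ)⁻¹ + θ) := (Real.rpow_add hp0 _ _).symm
    _ ≤ (p : ℝ) ^ (1 / 2 : ℝ) := Real.rpow_le_rpow_of_exponent_le hp1 (by linarith)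
    _ = √p := (Real.sqrt_eq_rpow _).symm

/-- Uniform power saving for complete `k`-th power sums. -/
theorem exists_norm_powSum_le {k : ℕ} (hk : 2 ≤ k) {θ : ℝ} (hθ0 : 0 ≤ θ) (hθ : k * θ ≤ 1)
    (hθ' : θ ≤ 21 / 50) :
    ∃ C : ℝ, 0 < C ∧ ∀ (q : ℕ) [NeZero q] (ψ : AddChar (ZMod q) ℂ), ψ.IsPrimitive →
      ‖powSum k ψ‖ ≤ C * (q : ℝ) ^ (1 - θ) := by
  set P := (2 * k) ^ 13 with hP
  have hpos : 0 < ∏ p ∈ Icc 1 P, p ^ 2 :=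
    prod_pos fun p hp => pow_pos (mem_Icc.1 hp).1 2
  refine ⟨((∏ p ∈ Icc 1 P, p ^ 2 : ℕ) : ℝ), by exact_mod_cast hpos, fun q _ ψ hψ => ?_⟩
  have h := norm_powSum_zmod_le (k := k) (θ := θ)
    (c := fun p => ((if p ≤ P then p ^ 2 else 1 : ℕ) : ℝ)) ?_ q ψ hψ
  · refine h.trans (mul_le_mul_of_nonneg_right ?_ (by positivity))
    rw [← Nat.cast_prod, ← prod_filter]
    refine Nat.cast_le.2 (Nat.le_of_dvd hpos (prod_dvd_prod_of_subset _ _ _ fun p hp => ?_))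
    rw [mem_filter] at hp
    exact mem_Icc.2 ⟨(Nat.prime_of_mem_primeFactors hp.1).one_lt.le, hp.2⟩
  · intro p m hp _ ψ hψ
    have : Fact p.Prime := ⟨hp⟩
    by_cases hpP : p ≤ P
    · simp only [if_pos hpP, Nat.cast_pow p 2]
      exact norm_powSum_prime_pow_le (by omega) hθ0 hθ m hψ
    · simp only [if_neg hpP, Nat.cast_one]
      have hkP : k ≤ P := by
        calc k ≤ 2 * k := by omega
          _ ≤ P := Nat.le_self_pow (by norm_num) _
      exact norm_powSum_large_prime_pow_le hk hθ (by omega)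
        (two_mul_mul_rpow_le_sqrt hθ' (by omega)) m hψ

end Modulus

theorem e_eq_stdAddChar (q : ℕ) [NeZero q] (j : ℕ) :
    e ((j : ℝ) / q) = ZMod.stdAddChar (j : ZMod q) := by
  have := ZMod.stdAddChar_coe (N := q) j
  rw [Int.cast_natCast] at this
  rw [this, e]
  congr 1
  push_cast
  ring

theorem warGauss_eq_powSum (k q a : ℕ) [NeZero q] :
    warGauss k q a =
      (q : ℂ)⁻¹ * powSum k ((ZMod.stdAddChar (N := q)).mulShift (a : ZMod q)) := by
  rw [warGauss, powSum]
  congr 1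
  refine sum_bij (fun r _ => (r : ZMod q)) (fun _ _ => mem_univ _) ?_ ?_ ?_
  · intro r hr s hs h
    rw [mem_Icc] at hr hs
    rw [ZMod.natCast_eq_natCast_iff] at h
    rcases le_total r s with hrs | hrs
    · have := (Nat.modEq_iff_dvd' hrs).1 h
      have := Nat.eq_zero_of_dvd_of_lt this (by omega)
      omega
    · have := (Nat.modEq_iff_dvd' hrs).1 h.symm
      have := Nat.eq_zero_of_dvd_of_lt this (by omega)
      omega
  · intro x _
    have hq := NeZero.ne q
    by_cases hx : x = 0
    · exact ⟨q, mem_Icc.2 ⟨by omega, le_rfl⟩, by simp [hx]⟩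
    · have hv : x.val ≠ 0 := by rwa [Ne, ZMod.val_eq_zero]
      exact ⟨x.val, mem_Icc.2 ⟨by omega, (ZMod.val_lt x).le⟩, by simp⟩
  · intro r _
    have h := e_eq_stdAddChar q (a * r ^ k)
    push_cast at h
    rw [AddChar.mulShift_apply, h]

theorem isPrimitive_mulShift_of_coprime {q a : ℕ} [NeZero q] (h : a.Coprime q) :
    ((ZMod.stdAddChar (N := q)).mulShift (a : ZMod q)).IsPrimitive := by
  intro b hb
  rw [AddChar.mulShift_mulShift]
  exact ZMod.isPrimitive_stdAddChar q
    (fun h0 => hb ((((ZMod.isUnit_iff_coprime a q).2 h).mul_right_eq_zero).1 h0))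

theorem norm_warGauss_le_one (k q a : ℕ) [NeZero q] : ‖warGauss k q a‖ ≤ 1 := by
  rw [warGauss_eq_powSum, norm_mul, norm_inv, Complex.norm_natCast]
  refine inv_mul_le_one_of_le₀ ?_ (by positivity)
  simpa using norm_powSum_le_card k ((ZMod.stdAddChar (N := q)).mulShift (a : ZMod q))

theorem norm_e (x : ℝ) : ‖e x‖ = 1 := by
  rw [e, show 2 * (Real.pi : ℂ) * Complex.I * x = ((2 * Real.pi * x : ℝ) : ℂ) * Complex.I by
    push_cast; ring]
  exact Complex.norm_exp_ofReal_mul_I _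

theorem mul_le_two_pow_add_one {k : ℕ} (hk : 2 ≤ k) : 21 * k ≤ 10 * (2 ^ k + 1) := by
  induction k, hk using Nat.le_induction with
  | base => norm_num
  | succ n hn ih =>
    have : 2 ^ 2 ≤ 2 ^ n := Nat.pow_le_pow_right (by norm_num) hn
    rw [pow_succ]
    omega

theorem singular_series_inner_sum_bound (k : ℕ) (hk : 2 ≤ k) :
    ∃ C : ℝ, 0 < C ∧ ∀ d : ℕ, 2 ^ k + 1 ≤ d → ∀ N : ℕ, ∀ q : ℕ, 1 ≤ q →
      ‖∑ a ∈ (Finset.Icc 1 q).filter (fun a => Nat.Coprime a q),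
          (warGauss k q a) ^ d * e (-((N : ℝ) * a / q))‖ ≤ C * (q : ℝ) ^ (-(11 : ℝ) / 10) := by
  set D : ℕ := 2 ^ k + 1 with hD
  have hD5 : (5 : ℝ) ≤ D := by
    have : 2 ^ 2 ≤ 2 ^ k := Nat.pow_le_pow_right (by norm_num) hk
    exact_mod_cast (by omega : 5 ≤ D)
  have hkD : (21 * k : ℝ) ≤ 10 * D := by exact_mod_cast mul_le_two_pow_add_one hk
  set θ : ℝ := 21 / 10 / D with hθ
  have hθD : θ * D = 21 / 10 := div_mul_cancel₀ _ (by linarith)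
  have hθ0 : 0 ≤ θ := by positivity
  obtain ⟨C, hC, hbound⟩ := exists_norm_powSum_le hk hθ0
    (by rw [hθ, mul_div_assoc', div_le_one (by linarith)]; linarith) (by nlinarith)
  refine ⟨C ^ D, pow_pos hC D, fun d hd N q hq => ?_⟩
  have : NeZero q := ⟨by omega⟩
  have hq0 : (0 : ℝ) < q := by exact_mod_cast hq
  have hterm : ∀ a ∈ (Icc 1 q).filter (fun a => Nat.Coprime a q),
      ‖(warGauss k q a) ^ d * e (-((N : ℝ) * a / q))‖ ≤ C ^ D * (q : ℝ) ^ (-(21 : ℝ) / 10) := by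
    intro a ha
    have hG : ‖warGauss k q a‖ ≤ C * (q : ℝ) ^ (-θ) := by
      have h := hbound q _ (isPrimitive_mulShift_of_coprime (mem_filter.1 ha).2)
      rw [warGauss_eq_powSum, norm_mul, norm_inv, Complex.norm_natCast, inv_mul_le_iff₀ hq0]
      refine h.trans_eq ?_
      rw [sub_eq_add_neg, Real.rpow_add hq0, Real.rpow_one]
      ring
    rw [norm_mul, norm_e, mul_one, norm_pow]
    calc ‖warGauss k q a‖ ^ d ≤ ‖warGauss k q a‖ ^ D :=
          pow_le_pow_of_le_one (norm_nonneg _) (norm_warGauss_le_one k q a) hd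
      _ ≤ (C * (q : ℝ) ^ (-θ)) ^ D := by gcongr
      _ = C ^ D * (q : ℝ) ^ (-(21 : ℝ) / 10) := by
          rw [mul_pow, ← Real.rpow_natCast ((q : ℝ) ^ (-θ)), ← Real.rpow_mul hq0.le, neg_mul, hθD,
            neg_div]
  calc _ ≤ ∑ a ∈ (Icc 1 q).filter (fun a => Nat.Coprime a q),
        C ^ D * (q : ℝ) ^ (-(21 : ℝ) / 10) := norm_sum_le_of_le _ hterm
    _ ≤ q * (C ^ D * (q : ℝ) ^ (-(21 : ℝ) / 10)) := by
        rw [sum_const, nsmul_eq_mul]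
        gcongr
        exact (card_filter_le _ _).trans (by simp)
    _ = C ^ D * (q : ℝ) ^ (-(11 : ℝ) / 10) := by
        rw [show (-(11 : ℝ) / 10) = 1 + -(21 : ℝ) / 10 by norm_num, Real.rpow_add hq0,
          Real.rpow_one]
        ring
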